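/- arXiv:2004.03526 — 10 statements merged into one kernel-verified Lean document; each statement's English description precedes it below -/
import Mathlib

section
/- Let s ≥ 1, let λ be a nonzero real number, and let D be a symmetric s×s real matrix such that D·J_s(λ) is skew-symmetric, where J_s(λ) is the s×s Jordan block with eigenvalue λ. Then D = 0. -/
open Matrix

/-- The `s×s` Jordan block with eigenvalue `lam`: `lam` on the main diagonal,
`1` on the superdiagonal, `0` elsewhere. -/
def jordanBlock (s : ℕ) (lam : ℝ) : Matrix (Fin s) (Fin s) ℝ :=
  Matrix.of fun i j =>
    if (j : ℕ) = (i : ℕ) then lam else if (j : ℕ) = (i : ℕ) + 1 then 1 else 0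

theorem mul_jordanBlock_apply_of_zero (s : ℕ) (lam : ℝ) (D : Matrix (Fin s) (Fin s) ℝ)
    (i j : Fin s) (h : ∀ k : Fin s, (k : ℕ) < j → D i k = 0) :
    (D * jordanBlock s lam) i j = D i j * lam := by
  rw [Matrix.mul_apply, Finset.sum_eq_single j]
  · simp [jordanBlock]
  · intro k _ hk
    have hk' : (j : ℕ) ≠ k := fun e => hk (Fin.ext e.symm)
    by_cases h1 : (j : ℕ) = k + 1
    · rw [h k (by omega), zero_mul]
    · simp [jordanBlock, hk', h1]
  · simp

theorem stmt5 (s : ℕ) (hs : 1 ≤ s) (lam : ℝ) (hlam : lam ≠ 0)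
    (D : Matrix (Fin s) (Fin s) ℝ) (hsymm : Dᵀ = D)
    (hskew : (D * jordanBlock s lam)ᵀ = -(D * jordanBlock s lam)) :
    D = 0 := by
  have key : ∀ n : ℕ, ∀ i j : Fin s, (i : ℕ) + j = n → D i j = 0 := by
    intro n
    induction n using Nat.strong_induction_on with
    | _ n ih =>
      intro i j hij
      have e := congrFun (congrFun hskew i) j
      rw [Matrix.transpose_apply, Matrix.neg_apply,
        mul_jordanBlock_apply_of_zero s lam D j i
          (fun k hk => ih (j + k) (by omega) j k rfl),
        mul_jordanBlock_apply_of_zero s lam D i j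
          (fun k hk => ih (i + k) (by omega) i k rfl)] at e
      have e2 : D j i = D i j := congrFun (congrFun hsymm i) j
      rw [e2] at e
      have e3 : D i j * lam = 0 := by linarith
      exact (mul_eq_zero.mp e3).resolve_right hlam
  ext i j
  exact key _ i j rfl
end

section
/- Let s₁, s₂ ≥ 1 and let λ be a nonzero real number. Let D be a symmetric (s₁+s₂)×(s₁+s₂) real matrix, written in block form D = [[D₁₁, D₁₂], [D₁₂ᵀ, D₂₂]] with D₁₁ of size s₁×s₁ and D₂₂ of size s₂×s₂, such that D·diag(J_{s₁}(λ), J_{s₂}(−λ)) is skew-symmetric, where diag(J_{s₁}(λ), J_{s₂}(−λ)) is the block diagonal matrix with blocks J_{s₁}(λ) and J_{s₂}(−λ). Then the diagonal blocks vanish: D₁₁ = 0 and D₂₂ = 0. -/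
open Matrix

theorem jordan_aux (s : ℕ) (lam : ℝ) (hlam : lam ≠ 0) (D : Matrix (Fin s) (Fin s) ℝ)
    (hD : Dᵀ = D) (h : (D * jordanBlock s lam)ᵀ = -(D * jordanBlock s lam)) : D = 0 := by
  have key : ∀ n : ℕ, ∀ i j : Fin s, (i : ℕ) + j = n → D i j = 0 := by
    intro n
    induction n using Nat.strong_induction_on with
    | _ n ih =>
      intro i j hij
      have row : ∀ a b : Fin s, (a : ℕ) + b = n →
          (D * jordanBlock s lam) a b = D a b * lam := by
        intro a b hab
        rw [Matrix.mul_apply, Finset.sum_eq_single b]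
        · simp [jordanBlock]
        · intro k _ hk
          have hk' : (b : ℕ) ≠ k := fun e => hk (Fin.ext e.symm)
          by_cases hb : (b : ℕ) = k + 1
          · rw [ih (a + k) (by omega) a k rfl, zero_mul]
          · simp [jordanBlock, hk', hb]
        · simp
      have e := congrFun (congrFun h i) j
      have d : D j i = D i j := congrFun (congrFun hD i) j
      rw [Matrix.transpose_apply, Matrix.neg_apply, row j i (by omega), row i j hij, d] at e
      have : D i j * lam = 0 := by linarith
      exact (mul_eq_zero.mp this).resolve_right hlam
  ext i j
  exact key _ i j rfl

theorem stmt10 (s₁ s₂ : ℕ) (hs₁ : 1 ≤ s₁) (hs₂ : 1 ≤ s₂)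
    (lam : ℝ) (hlam : lam ≠ 0)
    (D₁₁ : Matrix (Fin s₁) (Fin s₁) ℝ)
    (D₁₂ : Matrix (Fin s₁) (Fin s₂) ℝ)
    (D₂₂ : Matrix (Fin s₂) (Fin s₂) ℝ)
    (hsymm : (Matrix.fromBlocks D₁₁ D₁₂ D₁₂ᵀ D₂₂)ᵀ = Matrix.fromBlocks D₁₁ D₁₂ D₁₂ᵀ D₂₂)
    (hskew :
      (Matrix.fromBlocks D₁₁ D₁₂ D₁₂ᵀ D₂₂ *
          Matrix.fromBlocks (jordanBlock s₁ lam) 0 0 (jordanBlock s₂ (-lam)))ᵀ =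
        -(Matrix.fromBlocks D₁₁ D₁₂ D₁₂ᵀ D₂₂ *
          Matrix.fromBlocks (jordanBlock s₁ lam) 0 0 (jordanBlock s₂ (-lam)))) :
    D₁₁ = 0 ∧ D₂₂ = 0 := by
  rw [Matrix.fromBlocks_transpose, Matrix.fromBlocks_inj] at hsymm
  rw [Matrix.fromBlocks_multiply, Matrix.fromBlocks_transpose, Matrix.fromBlocks_neg,
    Matrix.fromBlocks_inj] at hskew
  simp only [Matrix.mul_zero, add_zero, zero_add] at hskew
  exact ⟨jordan_aux s₁ lam hlam D₁₁ hsymm.1 hskew.1,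
    jordan_aux s₂ (-lam) (neg_ne_zero.mpr hlam) D₂₂ hsymm.2.2.2 hskew.2.2.2⟩
end

section
/- Let s ≥ 1 and let D be a symmetric s×s real matrix such that D·J_s(0) is skew-symmetric, where J_s(0) is the s×s nilpotent Jordan block. Then, indexing entries from 1 to s, D_{ij} = 0 for all indices i, j with i + j ≤ s; i.e., all entries of D strictly above the main anti-diagonal vanish. -/
open Matrix

theorem mul_jordanBlock_succ (s : ℕ) (D : Matrix (Fin s) (Fin s) ℝ) (i : Fin s) (k : ℕ)
    (hk : k + 1 < s) :
    (D * jordanBlock s 0) i ⟨k + 1, hk⟩ = D i ⟨k, by omega⟩ := by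
  rw [Matrix.mul_apply, Finset.sum_eq_single (⟨k, by omega⟩ : Fin s)]
  · simp [jordanBlock]
  · intro b _ hb
    have hb' : k ≠ (b : ℕ) := fun h => hb (Fin.ext h.symm)
    simp [jordanBlock, hb']
  · simp

theorem mul_jordanBlock_zero (s : ℕ) (D : Matrix (Fin s) (Fin s) ℝ) (i : Fin s)
    (hk : 0 < s) :
    (D * jordanBlock s 0) i ⟨0, hk⟩ = 0 := by
  rw [Matrix.mul_apply]
  apply Finset.sum_eq_zero
  intro b _
  simp [jordanBlock]

theorem stmt11 (s : ℕ) (hs : 1 ≤ s)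
    (D : Matrix (Fin s) (Fin s) ℝ) (hsymm : Dᵀ = D)
    (hskew : (D * jordanBlock s 0)ᵀ = -(D * jordanBlock s 0)) :
    -- with `1`-based indexing, `D_{ij} = 0` whenever `i + j ≤ s`
    ∀ i j : Fin s, ((i : ℕ) + 1) + ((j : ℕ) + 1) ≤ s → D i j = 0 := by
  have hs' : ∀ i j, D i j = D j i := fun i j => congrFun (congrFun hsymm j) i
  have hk : ∀ i j, (D * jordanBlock s 0) j i = -(D * jordanBlock s 0) i j :=
    fun i j => congrFun (congrFun hskew i) j
  have key : ∀ a b : ℕ, ∀ (ha : a < s) (hb : b < s), a + 1 + (b + 1) ≤ s →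
      D ⟨a, ha⟩ ⟨b, hb⟩ = 0 := by
    intro a
    induction a with
    | zero =>
      intro b ha hb h
      have h1 := hk ⟨b + 1, by omega⟩ ⟨0, ha⟩
      rw [mul_jordanBlock_succ, mul_jordanBlock_zero] at h1
      simpa using h1
    | succ a ih =>
      intro b ha hb h
      have h1 := hk ⟨b + 1, by omega⟩ ⟨a + 1, ha⟩
      rw [mul_jordanBlock_succ, mul_jordanBlock_succ, hs' ⟨b + 1, _⟩,
        ih (b + 1) (by omega) (by omega) (by omega)] at h1
      simpa using h1
  intro i j h
  exact key i j i.2 j.2 h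
end

section
/- Let s be an even positive integer and let D be a symmetric s×s real matrix such that D·J_s(0) is skew-symmetric, where J_s(0) is the s×s nilpotent Jordan block. Then the first column of D is zero, i.e., D·e₁ = 0 where e₁ is the first standard basis vector. Consequently D is singular, and e₁ is a nonzero vector in ker D ∩ ker J_s(0). -/
open Matrix

theorem stmt12 (s : ℕ) (hpos : 0 < s) (heven : Even s)
    (D : Matrix (Fin s) (Fin s) ℝ) (hsymm : Dᵀ = D)
    (hskew : (D * jordanBlock s 0)ᵀ = -(D * jordanBlock s 0)) :
    ∀ e₁ : Fin s → ℝ, e₁ = Pi.single (⟨0, hpos⟩ : Fin s) (1 : ℝ) →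
      D *ᵥ e₁ = 0 ∧ D.det = 0 ∧ jordanBlock s 0 *ᵥ e₁ = 0 ∧ e₁ ≠ 0 := by
  have hJ : ∀ (i j : Fin s) (k : Fin s), (k : ℕ) + 1 = j →
      (D * jordanBlock s 0) i j = D i k := by
    intro i j k hk
    rw [Matrix.mul_apply, Finset.sum_eq_single k]
    · simp [jordanBlock, ← hk]
    · intro b _ hb
      have h1 : ¬ ((j : ℕ) = (b : ℕ) + 1) := fun h => hb (Fin.ext (by omega))
      simp [jordanBlock, h1]
    · simp
  have hJ0 : ∀ i : Fin s, (D * jordanBlock s 0) i ⟨0, hpos⟩ = 0 := by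
    intro i
    rw [Matrix.mul_apply]
    apply Finset.sum_eq_zero
    intro b _
    simp [jordanBlock]
  have hsk : ∀ i j, (D * jordanBlock s 0) j i = -(D * jordanBlock s 0) i j := by
    intro i j
    have := congrFun (congrFun hskew i) j
    simpa only [Matrix.transpose_apply, Matrix.neg_apply] using this
  have hsy : ∀ i j, D j i = D i j := fun i j => congrFun (congrFun hsymm i) j
  have hlow : ∀ k : Fin s, (k : ℕ) + 1 < s → D ⟨0, hpos⟩ k = 0 := by
    intro k hk
    have h := hsk ⟨(k : ℕ) + 1, hk⟩ ⟨0, hpos⟩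
    rw [hJ _ _ k rfl, hJ0, neg_zero] at h
    exact h
  have hchain : ∀ k : ℕ, ∀ hk : k < s,
      D ⟨0, hpos⟩ ⟨s - 1, by omega⟩ = (-1) ^ k * D ⟨k, hk⟩ ⟨s - 1 - k, by omega⟩ := by
    intro k
    induction k with
    | zero => intro hk; simp
    | succ k ih =>
      intro hk
      rw [ih (by omega)]
      have h := hsk ⟨k + 1, hk⟩ ⟨s - 1 - k, by omega⟩
      rw [hJ _ _ ⟨k, by omega⟩ rfl,
        hJ _ _ ⟨s - 1 - (k + 1), by omega⟩ (by simp only; omega), hsy] at h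
      rw [h, pow_succ]
      ring
  have hlast : D ⟨0, hpos⟩ ⟨s - 1, by omega⟩ = 0 := by
    have h := hchain (s - 1) (by omega)
    have hodd : Odd (s - 1) := Nat.Even.sub_odd hpos heven odd_one
    have h0 : (⟨s - 1 - (s - 1), by omega⟩ : Fin s) = ⟨0, hpos⟩ := Fin.ext (by simp)
    rw [hodd.neg_one_pow, h0, hsy] at h
    rw [hsy]
    linarith
  have hrow : ∀ k : Fin s, D ⟨0, hpos⟩ k = 0 := by
    intro k
    by_cases hk : (k : ℕ) + 1 < s
    · exact hlow k hk
    · have : k = ⟨s - 1, by omega⟩ := Fin.ext (by simp only; omega)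
      rw [this]; exact hlast
  intro e₁ he
  subst he
  refine ⟨?_, Matrix.det_eq_zero_of_row_eq_zero _ hrow, ?_, ?_⟩
  · ext i
    simp [hsy _ i, hrow]
  · ext i
    simp [jordanBlock]
  · simp
end

section
/- Let s be an odd positive integer. Then there exists a symmetric invertible s×s real matrix D such that D·J_s(0) is skew-symmetric, where J_s(0) is the s×s nilpotent Jordan block. (For instance, the anti-diagonal matrix with entries D_{i, s+1−i} = (−1)^{i+1} and all other entries zero works.) -/
open Matrix

theorem antidiag_mul (s : ℕ) (M : Matrix (Fin s) (Fin s) ℝ) (i j : Fin s) :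
    ((Matrix.of fun i j : Fin s => if (i : ℕ) + j + 1 = s then (-1 : ℝ) ^ (i : ℕ) else 0) * M) i j
      = (-1 : ℝ) ^ (i : ℕ) * M (Fin.rev i) j := by
  rw [Matrix.mul_apply, Finset.sum_eq_single (Fin.rev i)]
  · have : (i : ℕ) + (Fin.rev i : Fin s) + 1 = s := by
      rw [Fin.val_rev]; omega
    simp only [Matrix.of_apply, if_pos this]
  · intro k _ hk
    have : ¬ ((i : ℕ) + k + 1 = s) := by
      intro h
      apply hk
      ext
      rw [Fin.val_rev]; omega
    simp only [Matrix.of_apply, if_neg this, zero_mul]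
  · simp

theorem neg_one_pow_of_even_add {a b : ℕ} (h : Even (a + b)) : (-1 : ℝ) ^ a = (-1) ^ b := by
  rcases Nat.even_or_odd b with hb | hb
  · rw [hb.neg_one_pow, ((Nat.even_add.1 h).2 hb).neg_one_pow]
  · have ha : Odd a := by
      rw [← Nat.not_even_iff_odd] at hb ⊢
      exact fun h' => hb ((Nat.even_add.1 h).1 h')
    rw [hb.neg_one_pow, ha.neg_one_pow]

theorem stmt13 (s : ℕ) (hodd : Odd s) :
    ∃ D : Matrix (Fin s) (Fin s) ℝ,
      Dᵀ = D ∧ IsUnit D ∧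
      (D * jordanBlock s 0)ᵀ = -(D * jordanBlock s 0) := by
  obtain ⟨m, hm⟩ := hodd
  refine ⟨Matrix.of fun i j : Fin s => if (i : ℕ) + j + 1 = s then (-1 : ℝ) ^ (i : ℕ) else 0,
    ?_, ?_, ?_⟩
  · ext i j
    simp only [Matrix.transpose_apply, Matrix.of_apply]
    by_cases h : (i : ℕ) + j + 1 = s
    · rw [if_pos h, if_pos (by omega)]
      exact neg_one_pow_of_even_add ⟨m, by omega⟩
    · rw [if_neg h, if_neg (by omega)]
  · refine IsUnit.of_mul_eq_one (Matrix.of fun i j : Fin s =>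
      if (i : ℕ) + j + 1 = s then (-1 : ℝ) ^ (i : ℕ) else 0) ?_
    ext i j
    rw [antidiag_mul]
    simp only [Matrix.of_apply, Matrix.one_apply, Fin.val_rev]
    have hi := i.isLt
    by_cases h : i = j
    · subst h
      rw [if_pos (by omega), if_pos rfl, ← pow_add]
      exact Even.neg_one_pow ⟨m, by omega⟩
    · have : (i : ℕ) ≠ j := fun h' => h (Fin.ext h')
      rw [if_neg (by omega), if_neg h, mul_zero]
  · ext i j
    rw [Matrix.transpose_apply, Matrix.neg_apply, antidiag_mul, antidiag_mul]
    simp only [jordanBlock, Matrix.of_apply, Fin.val_rev]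
    have hi := i.isLt
    have hj := j.isLt
    by_cases h : (i : ℕ) + j = s
    · have e : (-1 : ℝ) ^ (j : ℕ) = (-1) ^ ((i : ℕ) + 1) :=
        neg_one_pow_of_even_add ⟨m + 1, by omega⟩
      rw [if_neg (by omega), if_pos (by omega), if_neg (by omega), if_pos (by omega), e]
      ring
    · have h1 : ¬ ((i : ℕ) = s - (j + 1) + 1) := by omega
      have h2 : ¬ ((j : ℕ) = s - (i + 1) + 1) := by omega
      simp [h1, h2]
end

section
/- Let t be a positive integer and let B = diag(J_{2t}(0), J_{2t}(0)) be the 4t×4t block diagonal matrix consisting of two copies of the even dimensional nilpotent Jordan block J_{2t}(0). Then there exists a symmetric invertible 4t×4t real matrix D such that D·B is skew-symmetric. (For instance D = [[0, K], [Kᵀ, 0]] works, where K is the 2t×2t anti-diagonal matrix with entries K_{i, 2t+1−i} = (−1)^{i+1}.) -/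
open Matrix

/-- The signed anti-diagonal matrix. -/
def signedRev (n : ℕ) : Matrix (Fin n) (Fin n) ℝ :=
  Matrix.of fun i j => if j = Fin.rev i then (-1) ^ (i : ℕ) else 0

lemma signedRev_mul_transpose (n : ℕ) : signedRev n * (signedRev n)ᵀ = 1 := by
  ext i j
  simp only [Matrix.mul_apply, Matrix.transpose_apply, signedRev, Matrix.of_apply, ite_mul,
    zero_mul, Finset.sum_ite_eq', Finset.sum_ite_eq, Finset.mem_univ, if_true, Fin.rev_inj,
    Matrix.one_apply]
  by_cases h : i = j
  · subst h
    simp [← mul_pow]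
  · simp [h]

lemma jordan_signedRev (n : ℕ) :
    (jordanBlock n 0)ᵀ * signedRev n = -(signedRev n * jordanBlock n 0) := by
  ext i j
  have e : ∀ k : Fin n, (j = Fin.rev k) ↔ k = Fin.rev j := fun k =>
    ⟨fun h => by rw [h, Fin.rev_rev], fun h => by rw [h, Fin.rev_rev]⟩
  simp only [Matrix.mul_apply, Matrix.neg_apply, Matrix.transpose_apply, signedRev,
    Matrix.of_apply, ite_mul, mul_ite, mul_zero, e,
    zero_mul, Finset.sum_ite_eq', Finset.sum_ite_eq, Finset.mem_univ, if_true]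
  have hi := i.isLt
  have hj := j.isLt
  simp only [jordanBlock, Matrix.of_apply, Fin.val_rev]
  by_cases h : (i : ℕ) + j = n
  · have h1 : (i : ℕ) = n - (j + 1) + 1 := by omega
    have h2 : (j : ℕ) = n - (i + 1) + 1 := by omega
    have h3 : ¬ (i : ℕ) = n - (j + 1) := by omega
    have h4 : ¬ (j : ℕ) = n - (i + 1) := by omega
    rw [if_neg h3, if_pos h1, if_neg h4, if_pos h2]
    have h5 : ((-1 : ℝ)) ^ (i : ℕ) = (-1) ^ (n - ((j : ℕ) + 1) + 1) := by rw [← h1]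
    rw [h5, pow_succ]
    ring
  · have h1 : ¬ (i : ℕ) = n - (j + 1) + 1 := by omega
    have h2 : ¬ (j : ℕ) = n - (i + 1) + 1 := by omega
    simp [h1, h2]

theorem stmt14 (t : ℕ) (ht : 0 < t) :
    ∃ D : Matrix (Fin (2 * t) ⊕ Fin (2 * t)) (Fin (2 * t) ⊕ Fin (2 * t)) ℝ,
      Dᵀ = D ∧ IsUnit D ∧
      (D * Matrix.fromBlocks (jordanBlock (2 * t) 0) 0 0 (jordanBlock (2 * t) 0))ᵀ =
        -(D * Matrix.fromBlocks (jordanBlock (2 * t) 0) 0 0 (jordanBlock (2 * t) 0)) := by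
  have h1 := signedRev_mul_transpose (2 * t)
  have h2 : (signedRev (2 * t))ᵀ * signedRev (2 * t) = 1 := mul_eq_one_comm.mp h1
  have h3 := jordan_signedRev (2 * t)
  have h4 := congrArg Matrix.transpose h3
  simp only [Matrix.transpose_mul, Matrix.transpose_neg, Matrix.transpose_transpose] at h4
  refine ⟨Matrix.fromBlocks 0 (signedRev (2 * t)) (signedRev (2 * t))ᵀ 0, ?_, ?_, ?_⟩
  · simp [Matrix.fromBlocks_transpose]
  · refine IsUnit.of_mul_eq_one
      (Matrix.fromBlocks 0 (signedRev (2 * t)) (signedRev (2 * t))ᵀ 0) ?_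
    simp [Matrix.fromBlocks_multiply, h1, h2]
  · simp [Matrix.fromBlocks_multiply, Matrix.fromBlocks_transpose, Matrix.fromBlocks_neg, h3, h4]
end

section
/- Let s ≥ 1 and let λ be a nonzero real number. Then there exists a symmetric invertible 2s×2s real matrix D such that D·diag(J_s(λ), J_s(−λ)) is skew-symmetric, where diag(J_s(λ), J_s(−λ)) is the block diagonal matrix with blocks J_s(λ) and J_s(−λ). (For instance D = [[0, K], [Kᵀ, 0]] works, where K is the s×s anti-diagonal matrix with entries K_{i, s+1−i} = (−1)^{i+1}.) In particular, the linear system u' = diag(J_s(λ), J_s(−λ))·u is Hamiltonian with respect to a constant symplectic structure. -/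
open Matrix

/-- The alternating anti-diagonal matrix. -/
def altAnti (s : ℕ) : Matrix (Fin s) (Fin s) ℝ :=
  Matrix.of fun i j => if j = Fin.rev i then (-1) ^ (i : ℕ) else 0

lemma altAnti_mul (s : ℕ) (A : Matrix (Fin s) (Fin s) ℝ) (i j : Fin s) :
    (altAnti s * A) i j = (-1) ^ (i : ℕ) * A (Fin.rev i) j := by
  simp [altAnti, Matrix.mul_apply]

lemma mul_altAnti (s : ℕ) (A : Matrix (Fin s) (Fin s) ℝ) (i j : Fin s) :
    (A * altAnti s) i j = A i (Fin.rev j) * (-1) ^ (Fin.rev j : ℕ) := by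
  have h : ∀ k : Fin s, (j = Fin.rev k) ↔ (k = Fin.rev j) := fun k => by
    constructor <;> rintro rfl <;> simp
  simp only [altAnti, Matrix.mul_apply, Matrix.of_apply, h]
  simp

lemma altAnti_mul_transpose (s : ℕ) : altAnti s * (altAnti s)ᵀ = 1 := by
  ext i j
  rw [altAnti_mul]
  by_cases h : i = j
  · subst h
    simp [altAnti, ← mul_pow]
  · simp [altAnti, h]

lemma jordan_altAnti (s : ℕ) (lam : ℝ) :
    (jordanBlock s lam)ᵀ * altAnti s = -(altAnti s * jordanBlock s (-lam)) := by
  ext i j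
  rw [mul_altAnti, Matrix.neg_apply, altAnti_mul]
  simp only [jordanBlock, Matrix.transpose_apply, Matrix.of_apply]
  have hi := i.isLt
  have hj := j.isLt
  by_cases h1 : (i : ℕ) = (Fin.rev j : ℕ)
  · have h2 : (j : ℕ) = (Fin.rev i : ℕ) := by
      rw [Fin.val_rev] at *; omega
    rw [if_pos h1, if_pos h2, h1]; ring
  · have h2 : ¬ (j : ℕ) = (Fin.rev i : ℕ) := by
      rw [Fin.val_rev] at *; omega
    rw [if_neg h1, if_neg h2]
    by_cases h3 : (i : ℕ) = (Fin.rev j : ℕ) + 1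
    · have h4 : (j : ℕ) = (Fin.rev i : ℕ) + 1 := by
        rw [Fin.val_rev] at *; omega
      rw [if_pos h3, if_pos h4, h3]; ring
    · have h4 : ¬ (j : ℕ) = (Fin.rev i : ℕ) + 1 := by
        rw [Fin.val_rev] at *; omega
      rw [if_neg h3, if_neg h4]; ring

theorem stmt15 (s : ℕ) (hs : 1 ≤ s) (lam : ℝ) (hlam : lam ≠ 0) :
    ∃ D : Matrix (Fin s ⊕ Fin s) (Fin s ⊕ Fin s) ℝ,
      Dᵀ = D ∧ IsUnit D ∧
      (D * Matrix.fromBlocks (jordanBlock s lam) 0 0 (jordanBlock s (-lam)))ᵀ =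
        -(D * Matrix.fromBlocks (jordanBlock s lam) 0 0 (jordanBlock s (-lam))) := by
  have hK := altAnti_mul_transpose s
  have hK' : (altAnti s)ᵀ * altAnti s = 1 := mul_eq_one_comm.mp hK
  have h1 := jordan_altAnti s lam
  have h2 := congrArg Matrix.transpose h1
  rw [Matrix.transpose_mul, Matrix.transpose_transpose, Matrix.transpose_neg,
    Matrix.transpose_mul] at h2
  refine ⟨Matrix.fromBlocks 0 (altAnti s) (altAnti s)ᵀ 0, ?_, ?_, ?_⟩
  · simp [Matrix.fromBlocks_transpose]
  · apply IsUnit.of_mul_eq_one (Matrix.fromBlocks 0 (altAnti s) (altAnti s)ᵀ 0)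
    simp [Matrix.fromBlocks_multiply, hK, hK']
  · simp [Matrix.fromBlocks_multiply, Matrix.fromBlocks_transpose, Matrix.fromBlocks_neg, h1, h2]
end

section
/- Let B be an invertible m×m real matrix and let D be a symmetric m×m real matrix such that D·B is skew-symmetric. Let C be an m×m real matrix such that B·C = C·B and D·C is skew-symmetric. Then the matrix D·B⁻¹·C is symmetric. (Hence the quadratic function H_C defined by ∇H_C(u) = (D·B⁻¹)·C·u is well defined, and the vector field u ↦ C·u is Hamiltonian with respect to the presymplectic structure D·B⁻¹ with Hamiltonian H_C.) -/
open Matrix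

theorem stmt17 (m : ℕ) (B D C : Matrix (Fin m) (Fin m) ℝ)
    (hB : IsUnit B) (hsymm : Dᵀ = D) (hskew : (D * B)ᵀ = -(D * B))
    (hcomm : B * C = C * B) (hDC : (D * C)ᵀ = -(D * C)) :
    (D * B⁻¹ * C)ᵀ = D * B⁻¹ * C := by
  have hdet : IsUnit B.det := (Matrix.isUnit_iff_isUnit_det B).mp hB
  have h1 : B * B⁻¹ = 1 := Matrix.mul_nonsing_inv B hdet
  have h2 : B⁻¹ * B = 1 := Matrix.nonsing_inv_mul B hdet
  generalize B⁻¹ = X at *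
  rw [Matrix.transpose_mul, hsymm] at hskew hDC
  have h3 : Xᵀ * Bᵀ = 1 := by rw [← Matrix.transpose_mul, h1, Matrix.transpose_one]
  have h4 : Xᵀ * D = -(D * X) := by
    calc Xᵀ * D = Xᵀ * (D * B) * X := by
          rw [Matrix.mul_assoc, Matrix.mul_assoc, h1, Matrix.mul_one]
      _ = Xᵀ * (-(Bᵀ * D)) * X := by rw [hskew, neg_neg]
      _ = -((Xᵀ * Bᵀ) * D * X) := by noncomm_ring
      _ = -(D * X) := by rw [h3, Matrix.one_mul]
  have h5 : C * X = X * C := by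
    calc C * X = (X * B) * C * X := by rw [h2, Matrix.one_mul]
      _ = X * (B * C) * X := by noncomm_ring
      _ = X * C * (B * X) := by rw [hcomm]; noncomm_ring
      _ = X * C := by rw [h1, Matrix.mul_one]
  calc (D * X * C)ᵀ = Cᵀ * (Xᵀ * D) := by
        rw [Matrix.transpose_mul, Matrix.transpose_mul, hsymm]
    _ = -(Cᵀ * D * X) := by rw [h4]; noncomm_ring
    _ = D * (C * X) := by rw [hDC]; noncomm_ring
    _ = D * X * C := by rw [h5, Matrix.mul_assoc]
end

section
/- Let B be an invertible m×m real matrix and let D be a symmetric m×m real matrix such that D·B is skew-symmetric. Let C₁ and C₂ be m×m real matrices such that B·C₁ = C₁·B, B·C₂ = C₂·B, C₁·C₂ = C₂·C₁, and both D·C₁ and D·C₂ are skew-symmetric. Then the matrix C₁ᵀ·(D·B⁻¹)·C₂ is skew-symmetric; equivalently, the presymplectic form ω represented by the skew-symmetric matrix D·B⁻¹ vanishes on the pair of linear vector fields X₁(u) = C₁·u and X₂(u) = C₂·u, i.e., uᵀ·C₁ᵀ·(D·B⁻¹)·C₂·u = 0 for every u ∈ ℝ^m. -/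
open Matrix

theorem stmt18 (m : ℕ) (B D C₁ C₂ : Matrix (Fin m) (Fin m) ℝ)
    (hB : IsUnit B) (hsymm : Dᵀ = D) (hskew : (D * B)ᵀ = -(D * B))
    (hcomm₁ : B * C₁ = C₁ * B) (hcomm₂ : B * C₂ = C₂ * B)
    (hcomm₁₂ : C₁ * C₂ = C₂ * C₁)
    (hDC₁ : (D * C₁)ᵀ = -(D * C₁)) (hDC₂ : (D * C₂)ᵀ = -(D * C₂)) :
    (C₁ᵀ * (D * B⁻¹) * C₂)ᵀ = -(C₁ᵀ * (D * B⁻¹) * C₂) ∧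
    ∀ u : Fin m → ℝ, u ⬝ᵥ ((C₁ᵀ * (D * B⁻¹) * C₂) *ᵥ u) = 0 := by
  have hdet : IsUnit B.det := (Matrix.isUnit_iff_isUnit_det B).mp hB
  have hBE : B * B⁻¹ = 1 := Matrix.mul_nonsing_inv B hdet
  have hEB : B⁻¹ * B = 1 := Matrix.nonsing_inv_mul B hdet
  generalize B⁻¹ = E at *
  rw [transpose_mul, hsymm] at hskew hDC₁ hDC₂
  have hEBt : Eᵀ * Bᵀ = 1 := by rw [← transpose_mul, hBE, transpose_one]
  have hE : Eᵀ * D = -(D * E) := by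
    have h : Eᵀ * (Bᵀ * D) * E = Eᵀ * (-(D * B)) * E := by rw [hskew]
    have h1 : Eᵀ * (Bᵀ * D) * E = D * E := by
      rw [← Matrix.mul_assoc, hEBt, Matrix.one_mul]
    have h2 : Eᵀ * (-(D * B)) * E = -(Eᵀ * D) := by
      rw [Matrix.mul_neg, Matrix.neg_mul, Matrix.mul_assoc, Matrix.mul_assoc, hBE,
        Matrix.mul_one]
    rw [h1, h2] at h
    rw [h, neg_neg]
  have comm : ∀ C : Matrix (Fin m) (Fin m) ℝ, B * C = C * B → C * E = E * C := by
    intro C h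
    calc C * E = (E * B) * C * E := by rw [hEB, Matrix.one_mul]
      _ = E * (B * C) * E := by simp only [Matrix.mul_assoc]
      _ = E * C * (B * E) := by rw [h]; simp only [Matrix.mul_assoc]
      _ = E * C := by rw [hBE, Matrix.mul_one]
  have hM : C₁ᵀ * (D * E) * C₂ = -(D * (E * (C₁ * C₂))) := by
    rw [← Matrix.mul_assoc C₁ᵀ, hDC₁]
    simp only [Matrix.neg_mul, Matrix.mul_assoc]
    rw [← Matrix.mul_assoc C₁, comm C₁ hcomm₁, Matrix.mul_assoc]
  have hN : C₂ᵀ * (D * E) * C₁ = -(D * (E * (C₁ * C₂))) := by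
    rw [← Matrix.mul_assoc C₂ᵀ, hDC₂, hcomm₁₂]
    simp only [Matrix.neg_mul, Matrix.mul_assoc]
    rw [← Matrix.mul_assoc C₂, comm C₂ hcomm₂, Matrix.mul_assoc]
  have key : (C₁ᵀ * (D * E) * C₂)ᵀ = -(C₁ᵀ * (D * E) * C₂) := by
    rw [transpose_mul, transpose_mul, transpose_mul, transpose_transpose, hsymm, hE, hM, ← hN]
    simp only [Matrix.neg_mul, Matrix.mul_neg, Matrix.mul_assoc]
  refine ⟨key, fun u => ?_⟩
  generalize C₁ᵀ * (D * E) * C₂ = M at key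
  have h : u ⬝ᵥ (M *ᵥ u) = -(u ⬝ᵥ (M *ᵥ u)) := by
    calc u ⬝ᵥ (M *ᵥ u) = u ⬝ᵥ (Mᵀ *ᵥ u) := by
          rw [mulVec_transpose, dotProduct_mulVec, dotProduct_comm]
      _ = -(u ⬝ᵥ (M *ᵥ u)) := by rw [key, neg_mulVec, dotProduct_neg]
  linarith
end

section
/- Let B be the 4×4 real matrix with rows (1,0,0,0), (0,1,0,0), (0,0,−1,1), (0,0,0,−1), i.e., B = diag(1, 1, J₂(−1)). Then every symmetric 4×4 real matrix D such that D·B is skew-symmetric is singular (has determinant zero). Consequently, there is no invertible symmetric D with D·B skew-symmetric, so the linear system u' = B·u is not Hamiltonian with respect to any constant symplectic structure, only with respect to a degenerate (presymplectic) one. -/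
open Matrix

theorem stmt19 :
    ∀ D : Matrix (Fin 4) (Fin 4) ℝ, Dᵀ = D →
      (D * !![(1:ℝ),0,0,0; 0,1,0,0; 0,0,-1,1; 0,0,0,-1])ᵀ =
        -(D * !![(1:ℝ),0,0,0; 0,1,0,0; 0,0,-1,1; 0,0,0,-1]) →
      D.det = 0 := by
  intro D hD h
  have s : ∀ i j, D j i = D i j := fun i j => congrFun (congrFun hD i) j
  have h03 := congrFun (congrFun h 0) 3
  have h13 := congrFun (congrFun h 1) 3
  have h22 := congrFun (congrFun h 2) 2
  have h23 := congrFun (congrFun h 2) 3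
  simp [Matrix.mul_apply, Fin.sum_univ_four] at h03 h13 h22 h23
  have s03 := s 0 3
  have s13 := s 1 3
  have s23 := s 2 3
  apply Matrix.det_eq_zero_of_column_eq_zero 2
  intro i
  fin_cases i <;> simp <;> linarith
end
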